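/- Convexity bound: for m ∈ [-1,1] let f_β(m) = -m²/2 - I(m)/β with I the binary entropy I(m) = -((1-m)/2)log((1-m)/2) - ((1+m)/2)log((1+m)/2). Then for β > 1, f_β has exactly two global minimizers on [-1,1], namely ±m_β where m_β is the positive solution of m = tanh(β m). -/

import Mathlib

/-- The binary entropy function. -/
noncomputable def binEntropy (m : ℝ) : ℝ :=
  -((1 - m) / 2) * Real.log ((1 - m) / 2) - ((1 + m) / 2) * Real.log ((1 + m) / 2)

/-- The mean-field free energy density. -/
noncomputable def fBeta (β m : ℝ) : ℝ := -m ^ 2 / 2 - binEntropy m / β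

theorem continuous_fBeta (β : ℝ) : Continuous (fBeta β) := by
  have h : fBeta β = fun m : ℝ =>
      -m ^ 2 / 2 - (Real.negMulLog ((1 - m) / 2) + Real.negMulLog ((1 + m) / 2)) / β := by
    funext m
    simp only [fBeta, binEntropy, Real.negMulLog]
    ring
  rw [h]
  have := Real.continuous_negMulLog
  fun_prop

theorem fBeta_neg (β m : ℝ) : fBeta β (-m) = fBeta β m := by
  simp only [fBeta, binEntropy, sub_neg_eq_add, ← sub_eq_add_neg]
  ring

theorem fBeta_abs (β m : ℝ) : fBeta β |m| = fBeta β m := by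
  rcases abs_choice m with h | h <;> rw [h]
  exact fBeta_neg β m

/-- `β` times the derivative of the free energy density, see `hasDerivAt_fBeta`. -/
noncomputable def fBetaSlope (β m : ℝ) : ℝ :=
  (Real.log (1 + m) - Real.log (1 - m)) / 2 - β * m

theorem hasDerivAt_fBeta {β m : ℝ} (hβ : β ≠ 0) (hm : m ∈ Set.Ioo (-1 : ℝ) 1) :
    HasDerivAt (fBeta β) (fBetaSlope β m / β) m := by
  obtain ⟨h1, h2⟩ := hm
  have ha : (1 - m) / 2 ≠ 0 := by linarith
  have hb : (1 + m) / 2 ≠ 0 := by linarith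
  have da : HasDerivAt (fun x : ℝ => (1 - x) / 2) (-1 / 2) m :=
    ((hasDerivAt_id m).const_sub 1).div_const 2
  have db : HasDerivAt (fun x : ℝ => (1 + x) / 2) (1 / 2) m :=
    ((hasDerivAt_id m).const_add 1).div_const 2
  have hd := (((hasDerivAt_pow 2 m).neg).div_const 2).sub
    (((da.neg.mul (da.log ha)).sub (db.mul (db.log hb))).div_const β)
  refine hd.congr_deriv ?_
  have h1' : 1 + m ≠ 0 := by linarith
  have h2' : 1 - m ≠ 0 := by linarith
  rw [fBetaSlope, Real.log_div h2' two_ne_zero, Real.log_div h1' two_ne_zero]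
  simp only [Pi.neg_apply]
  field_simp
  ring

theorem hasDerivAt_fBetaSlope {β m : ℝ} (hm : m ∈ Set.Ioo (-1 : ℝ) 1) :
    HasDerivAt (fBetaSlope β) (1 / (1 - m ^ 2) - β) m := by
  obtain ⟨h1, h2⟩ := hm
  have h1' : 1 + m ≠ 0 := by linarith
  have h2' : 1 - m ≠ 0 := by linarith
  have h3 : 1 - m ^ 2 ≠ 0 := by
    rw [show 1 - m ^ 2 = (1 + m) * (1 - m) by ring]
    exact mul_ne_zero h1' h2'
  have hd := ((((hasDerivAt_id m).const_add 1).log h1').sub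
    (((hasDerivAt_id m).const_sub 1).log h2')).div_const 2 |>.sub
    ((hasDerivAt_id m).const_mul β)
  refine hd.congr_deriv ?_
  simp only [id]
  field_simp
  ring

theorem strictConvexOn_fBetaSlope (β : ℝ) :
    StrictConvexOn ℝ (Set.Ico 0 1) (fBetaSlope β) := by
  refine StrictMonoOn.strictConvexOn_of_deriv (convex_Ico 0 1) (fun x hx => ?_) ?_
  · exact (hasDerivAt_fBetaSlope
      ⟨by linarith [hx.1], hx.2⟩).continuousAt.continuousWithinAt
  · rw [interior_Ico]
    intro x hx y hy hxy
    rw [(hasDerivAt_fBetaSlope ⟨by linarith [hx.1], hx.2⟩).deriv,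
      (hasDerivAt_fBetaSlope ⟨by linarith [hy.1], hy.2⟩).deriv]
    have hy2 : 0 < 1 - y ^ 2 := by nlinarith [hy.1, hy.2]
    have hxy2 : 1 - y ^ 2 < 1 - x ^ 2 := by nlinarith [hx.1, hy.1]
    linarith [one_div_lt_one_div_of_lt hy2 hxy2]

theorem fBetaSlope_zero (β : ℝ) : fBetaSlope β 0 = 0 := by simp [fBetaSlope]

theorem fBetaSlope_eq_zero {β m : ℝ} (hm : m ∈ Set.Ioo (-1 : ℝ) 1)
    (hfix : m = Real.tanh (β * m)) : fBetaSlope β m = 0 := by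
  have h : Real.artanh m = β * m := by
    conv_lhs => rw [hfix]
    exact Real.artanh_tanh _
  rw [Real.artanh_eq_half_log ⟨hm.1.le, hm.2.le⟩,
    Real.log_div (by linarith [hm.1]) (by linarith [hm.2])] at h
  rw [fBetaSlope]
  linarith

theorem fBetaSlope_neg_of_lt {β a x : ℝ} (ha : a < 1) (h0 : fBetaSlope β a = 0)
    (hx : 0 < x) (hxa : x < a) : fBetaSlope β x < 0 := by
  have h := (strictConvexOn_fBetaSlope β).slope_strict_mono_adjacent
    ⟨le_rfl, one_pos⟩ ⟨(hx.trans hxa).le, ha⟩ hx hxa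
  rw [fBetaSlope_zero, h0, sub_zero, sub_zero, zero_sub] at h
  by_contra! hc
  have h1 : 0 ≤ fBetaSlope β x / x := div_nonneg hc hx.le
  have h2 : -fBetaSlope β x / (a - x) ≤ 0 :=
    div_nonpos_of_nonpos_of_nonneg (by linarith) (by linarith)
  linarith

theorem fBetaSlope_pos_of_lt {β a x : ℝ} (ha : 0 < a) (h0 : fBetaSlope β a = 0)
    (hax : a < x) (hx : x < 1) : 0 < fBetaSlope β x := by
  have h := (strictConvexOn_fBetaSlope β).slope_strict_mono_adjacent
    ⟨le_rfl, one_pos⟩ ⟨(ha.trans hax).le, hx⟩ ha hax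
  rw [fBetaSlope_zero, h0, sub_zero, zero_div, sub_zero] at h
  exact (div_pos_iff_of_pos_right (sub_pos.2 hax)).1 h

theorem fBeta_lt_of_ne {β a x : ℝ} (hβ : 0 < β) (ha : a ∈ Set.Ioo (0 : ℝ) 1)
    (h0 : fBetaSlope β a = 0) (hx : x ∈ Set.Icc (0 : ℝ) 1) (hne : x ≠ a) :
    fBeta β a < fBeta β x := by
  rcases lt_or_gt_of_ne hne with hxa | hax
  · refine strictAntiOn_of_deriv_neg (convex_Icc 0 a) (continuous_fBeta β).continuousOn
      (fun y hy => ?_) ⟨hx.1, hxa.le⟩ ⟨ha.1.le, le_rfl⟩ hxa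
    rw [interior_Icc] at hy
    rw [(hasDerivAt_fBeta hβ.ne' ⟨by linarith [hy.1], hy.2.trans ha.2⟩).deriv]
    exact div_neg_of_neg_of_pos (fBetaSlope_neg_of_lt ha.2 h0 hy.1 hy.2) hβ
  · refine strictMonoOn_of_deriv_pos (convex_Icc a 1) (continuous_fBeta β).continuousOn
      (fun y hy => ?_) ⟨le_rfl, ha.2.le⟩ ⟨hax.le, hx.2⟩ hax
    rw [interior_Icc] at hy
    rw [(hasDerivAt_fBeta hβ.ne' ⟨by linarith [hy.1, ha.1], hy.2⟩).deriv]
    exact div_pos (fBetaSlope_pos_of_lt ha.1 h0 hy.1 hy.2) hβ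

/-- For β > 1 the free energy f_β has exactly two global minimizers on [-1,1],
namely ±m_β with m_β the positive solution of m = tanh(β m). -/
theorem fBeta_global_minimizers (β mβ : ℝ) (hβ : 1 < β)
    (hmβ : mβ ∈ Set.Ioo (0 : ℝ) 1) (hfix : mβ = Real.tanh (β * mβ)) :
    {m : ℝ | m ∈ Set.Icc (-1 : ℝ) 1 ∧
        ∀ m' ∈ Set.Icc (-1 : ℝ) 1, fBeta β m ≤ fBeta β m'} = {mβ, -mβ} := by
  have hmβ' : mβ ∈ Set.Ioo (-1 : ℝ) 1 := ⟨by linarith [hmβ.1], hmβ.2⟩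
  have h0 : fBetaSlope β mβ = 0 := fBetaSlope_eq_zero hmβ' hfix
  have hlt : ∀ m ∈ Set.Icc (-1 : ℝ) 1, |m| ≠ mβ → fBeta β mβ < fBeta β m := by
    intro m hm hne
    rw [← fBeta_abs β m]
    exact fBeta_lt_of_ne (by linarith) hmβ h0 ⟨abs_nonneg m, abs_le.2 hm⟩ hne
  ext m
  have habs : m ∈ ({mβ, -mβ} : Set ℝ) ↔ |m| = mβ := (abs_eq hmβ.1.le).symm
  rw [habs]
  constructor
  · rintro ⟨hm, hmin⟩
    by_contra hne
    exact (hlt m hm hne).not_ge (hmin mβ ⟨hmβ'.1.le, hmβ'.2.le⟩)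
  · intro h
    refine ⟨abs_le.1 (h.trans_le hmβ.2.le), fun m' hm' => ?_⟩
    rw [← fBeta_abs β m, h]
    by_cases h' : |m'| = mβ
    · rw [← fBeta_abs β m', h']
    · exact (hlt m' hm' h').le
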